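/- Let S be a countable set of positive reals having 0 as an accumulation point. The topological group Aut(U_S, <_lex) of bijective order-preserving self-isometries of (U_S, <_lex), equipped with the topology of pointwise convergence on the metric space U_S, is extremely amenable: every continuous action of this group on a nonempty compact Hausdorff space has a fixed point. -/

import Mathlib

open Classical

/-- Membership in `U_S` : the support of `x : S → ℚ` is contained in the range of some
strictly decreasing sequence of elements of `S` converging to `0`. -/
def USsupp (S : Set ℝ) (x : S → ℚ) : Prop :=
  ∃ f : ℕ → ℝ, StrictAnti f ∧ (∀ i, f i ∈ S) ∧
    Filter.Tendsto f Filter.atTop (nhds 0) ∧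
    ∀ s : S, x s ≠ 0 → ∃ i, (s : ℝ) = f i

/-- The space `U_S`, completion of `Q_S`. -/
def US (S : Set ℝ) := {x : S → ℚ // USsupp S x}

/-- The distance on `U_S` : `d x y = min {s ∈ S | x and y agree above s}` for `x ≠ y`,
and `d x x = 0`. -/
noncomputable def dU (S : Set ℝ) (x y : US S) : ℝ :=
  if x = y then 0
  else sInf {r : ℝ | r ∈ S ∧ ∀ t : S, r < (t : ℝ) → x.1 t = y.1 t}

/-- The lexicographical ordering on `U_S` : `x <lex y` iff `x s < y s` where `s` is
the largest element of `S` at which `x` and `y` differ (i.e. `s = d x y`). -/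
def lexU (S : Set ℝ) (x y : US S) : Prop :=
  ∃ s : S, x.1 s < y.1 s ∧ ∀ t : S, (s : ℝ) < (t : ℝ) → x.1 t = y.1 t

/-- The group `Aut(U_S, <lex)` of bijective order-preserving self-isometries of
`(U_S, <lex)`. -/
def AutU (S : Set ℝ) :=
  {g : US S ≃ US S //
    (∀ x y, dU S (g x) (g y) = dU S x y) ∧ (∀ x y, lexU S (g x) (g y) ↔ lexU S x y)}

instance (S : Set ℝ) : Group (AutU S) where
  mul g h := ⟨h.1.trans g.1,
    fun x y => by simp only [Equiv.trans_apply]; rw [g.2.1, h.2.1],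
    fun x y => by simp only [Equiv.trans_apply]; exact (g.2.2 _ _).trans (h.2.2 _ _)⟩
  one := ⟨Equiv.refl _, fun x y => rfl, fun x y => Iff.rfl⟩
  inv g := ⟨g.1.symm,
    fun x y => by have := g.2.1 (g.1.symm x) (g.1.symm y); simpa using this.symm,
    fun x y => by have := g.2.2 (g.1.symm x) (g.1.symm y); simpa using this.symm⟩
  mul_assoc a b c := Subtype.ext (Equiv.ext fun x => rfl)
  one_mul a := Subtype.ext (Equiv.ext fun x => rfl)
  mul_one a := Subtype.ext (Equiv.ext fun x => rfl)
  inv_mul_cancel g := Subtype.ext (Equiv.ext fun x => g.1.symm_apply_apply x)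

/-- `U_S` carries the metric topology of `dU`. -/
instance (S : Set ℝ) : TopologicalSpace (US S) :=
  TopologicalSpace.generateFrom
    {B : Set (US S) | ∃ x ε, 0 < ε ∧ B = {y | dU S x y < ε}}

/-- `Aut(U_S, <lex)` carries the topology of pointwise convergence on the metric
space `U_S` (for the group and its inverses). -/
instance (S : Set ℝ) : TopologicalSpace (AutU S) :=
  TopologicalSpace.induced
    (fun g : AutU S => ((g.1 : US S → US S), (g.1.symm : US S → US S)))
    inferInstance

open Uniformity

/-- Infinite Ramsey theorem for finite colourings of the `n`-element subsets of an infinite set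
of natural numbers. -/
theorem exists_infinite_monochromatic {κ : Type*} [Finite κ] (n : ℕ) :
    ∀ (c : Finset ℕ → κ) (S : Set ℕ), S.Infinite →
      ∃ T ⊆ S, T.Infinite ∧ ∃ k, ∀ B : Finset ℕ, (B : Set ℕ) ⊆ T → B.card = n → c B = k := by
  induction n with
  | zero =>
    intro c S hS
    refine ⟨S, subset_rfl, hS, c ∅, fun B _ hB => ?_⟩
    rw [Finset.card_eq_zero.1 hB]
  | succ n ih =>
    intro c S hS
    have step : ∀ R : {R : Set ℕ // R.Infinite}, ∃ a ∈ R.1, ∃ T : {T : Set ℕ // T.Infinite},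
        T.1 ⊆ R.1 ∧ (∀ t ∈ T.1, a < t) ∧
        ∃ k, ∀ B : Finset ℕ, (B : Set ℕ) ⊆ T.1 → B.card = n → c (insert a B) = k := by
      rintro ⟨R, hR⟩
      obtain ⟨a, ha⟩ := hR.nonempty
      have hR' : (R \ Set.Iic a).Infinite := hR.sdiff (Set.finite_Iic a)
      obtain ⟨T, hTR, hT, k, hk⟩ := ih (fun B => c (insert a B)) _ hR'
      exact ⟨a, ha, ⟨T, hT⟩, fun t ht => (hTR ht).1,
        fun t ht => not_le.1 (hTR ht).2, k, hk⟩
    choose pt hpt next hnext hlt col hcol using step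
    let R : ℕ → {R : Set ℕ // R.Infinite} := fun i => next^[i] ⟨S, hS⟩
    have hRsucc : ∀ i, R (i + 1) = next (R i) := fun i => Function.iterate_succ_apply' _ _ _
    have hanti : Antitone fun i => (R i).1 :=
      antitone_nat_of_succ_le fun i => by
        have := hnext (R i)
        rw [← hRsucc] at this
        exact this
    have hmem : ∀ i j, i < j → pt (R j) ∈ (next (R i)).1 := fun i j hij => by
      rw [← hRsucc]
      exact hanti hij (hpt (R j))
    have hmono : StrictMono fun i => pt (R i) := fun i j hij => hlt _ _ (hmem i j hij)
    obtain ⟨k, hk⟩ := Finite.exists_infinite_fiber fun i => col (R i)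
    rw [Set.infinite_coe_iff] at hk
    refine ⟨(fun i => pt (R i)) '' ((fun i => col (R i)) ⁻¹' {k}), ?_,
      hk.image hmono.injective.injOn, k, fun B hB hcard => ?_⟩
    · rintro _ ⟨i, -, rfl⟩
      exact hanti (Nat.zero_le i) (hpt (R i))
    · have hne : B.Nonempty := Finset.card_pos.1 (by omega)
      obtain ⟨i, hi, hmin⟩ := hB (B.min'_mem hne)
      have hmB : pt (R i) ∈ B := by
        have := B.min'_mem hne
        rwa [← hmin] at this
      rw [← Finset.insert_erase hmB, hcol (R i) (B.erase (pt (R i))) _ (by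
        rw [Finset.card_erase_of_mem hmB, hcard, Nat.add_sub_cancel])]
      · exact hi
      · intro b hb
        obtain ⟨hbne, hbB⟩ := Finset.mem_erase.1 hb
        obtain ⟨j, -, rfl⟩ := hB hbB
        refine hmem i j (hmono.lt_iff_lt.1 (lt_of_le_of_ne ?_ hbne.symm))
        have := B.min'_le _ hbB
        rwa [← hmin] at this

/-- Finite Ramsey theorem for the finite subsets of `ℚ`. -/
theorem exists_monochromatic_finset_rat {κ : Type*} [Finite κ] (c : Finset ℚ → κ) (n m : ℕ) :
    ∃ C : Finset ℚ, C.card = m ∧ ∃ k, ∀ B ⊆ C, B.card = n → c B = k := by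
  obtain ⟨T, -, hT, k, hk⟩ := exists_infinite_monochromatic n
    (fun B => c (B.map (Nat.castEmbedding : ℕ ↪ ℚ))) Set.univ Set.infinite_univ
  obtain ⟨C, hCT, hC⟩ := hT.exists_subset_card_eq m
  refine ⟨C.map Nat.castEmbedding, by simpa using hC, k, fun B hB hcard => ?_⟩
  obtain ⟨B, hBC, rfl⟩ := Finset.subset_map_iff.1 hB
  exact hk B (fun b hb => hCT (hBC hb)) (by simpa using hcard)

/-- Finite partial order isomorphisms of a countable dense linear order without endpoints extend
to automorphisms. -/
theorem Order.PartialIso.exists_orderIso {α : Type*} [LinearOrder α] [Countable α]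
    [DenselyOrdered α] [NoMinOrder α] [NoMaxOrder α] [Nonempty α] (p : Order.PartialIso α α) :
    ∃ h : α ≃o α, ∀ q ∈ p.1, h q.1 = q.2 := by
  cases nonempty_encodable α
  let to_cofinal : α ⊕ α → Order.Cofinal (Order.PartialIso α α) := fun x =>
    Sum.recOn x (Order.PartialIso.definedAtLeft α) (Order.PartialIso.definedAtRight α)
  let I : Order.Ideal (Order.PartialIso α α) := Order.idealOfCofinals p to_cofinal
  let F (a : α) := Order.PartialIso.funOfIdeal a I
    (Order.cofinal_meets_idealOfCofinals p to_cofinal (Sum.inl a))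
  let G (b : α) := Order.PartialIso.invOfIdeal b I
    (Order.cofinal_meets_idealOfCofinals p to_cofinal (Sum.inr b))
  have key : ∀ q r : α × α, (∃ f ∈ I, q ∈ f.1) → (∃ f ∈ I, r ∈ f.1) →
      cmp q.1 r.1 = cmp q.2 r.2 := by
    rintro q r ⟨f, hf, hq⟩ ⟨g, hg, hr⟩
    rcases I.directed _ hf _ hg with ⟨m, -, fm, gm⟩
    exact m.2 _ (fm hq) _ (gm hr)
  refine ⟨OrderIso.ofCmpEqCmp (fun a => (F a).1) (fun b => (G b).1) fun a b =>
    key (a, (F a).1) ((G b).1, b) (F a).2 (G b).2, fun q hq => ?_⟩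
  have := key q (q.1, (F q.1).1) ⟨p, Order.mem_idealOfCofinals p to_cofinal, hq⟩ (F q.1).2
  exact ((cmp_eq_eq_iff _ _).1 (this.symm.trans (cmp_self_eq_eq _))).symm

theorem exists_orderIso_map_finset {A B : Finset ℚ} (hAB : A.card = B.card) :
    ∃ h : ℚ ≃o ℚ, A.map h.toEquiv.toEmbedding = B := by
  let f := A.orderEmbOfFin hAB
  let g := B.orderEmbOfFin rfl
  obtain ⟨h, hh⟩ := Order.PartialIso.exists_orderIso
    (⟨Finset.univ.image fun i => (f i, g i), by
      simp only [Finset.mem_image, Finset.mem_univ, true_and]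
      rintro _ ⟨i, rfl⟩ _ ⟨j, rfl⟩
      rw [f.strictMono.cmp_map_eq, g.strictMono.cmp_map_eq]⟩ : Order.PartialIso ℚ ℚ)
  refine ⟨h, Finset.eq_of_subset_of_card_le (fun b hb => ?_) (by simp [hAB])⟩
  obtain ⟨a, ha, rfl⟩ := Finset.mem_map.1 hb
  have ha' : a ∈ Set.range f := by rw [Finset.range_orderEmbOfFin]; exact ha
  obtain ⟨i, rfl⟩ := ha'
  have := hh (f i, g i) (Finset.mem_image_of_mem _ (Finset.mem_univ i))
  simp only [Equiv.toEmbedding_apply, OrderIso.coe_toEquiv]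
  rw [this]
  exact Finset.orderEmbOfFin_mem _ _ _

theorem OrderIso.eqOn_of_map_finset_eq {A : Finset ℚ} {g h : ℚ ≃o ℚ}
    (hgh : A.map g.toEquiv.toEmbedding = A.map h.toEquiv.toEmbedding) :
    ∀ a ∈ A, g a = h a := by
  have hcard : (A.map h.toEquiv.toEmbedding).card = A.card := Finset.card_map _
  have hmem : ∀ i, A.orderEmbOfFin rfl i ∈ A := fun i => Finset.orderEmbOfFin_mem _ _ _
  have hg := Finset.orderEmbOfFin_unique hcard (f := g ∘ A.orderEmbOfFin rfl)
    (fun i => hgh ▸ Finset.mem_map_of_mem g.toEquiv.toEmbedding (hmem i))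
    (g.strictMono.comp (OrderEmbedding.strictMono _))
  have hh := Finset.orderEmbOfFin_unique hcard (f := h ∘ A.orderEmbOfFin rfl)
    (fun i => Finset.mem_map_of_mem h.toEquiv.toEmbedding (hmem i))
    (h.strictMono.comp (OrderEmbedding.strictMono _))
  intro a ha
  have ha' : a ∈ Set.range (A.orderEmbOfFin rfl) := by rw [Finset.range_orderEmbOfFin]; exact ha
  obtain ⟨i, rfl⟩ := ha'
  exact congrFun (hg.trans hh.symm) i

theorem exists_forall_smul_near {X : Type*} [UniformSpace X] [CompactSpace X]
    [MulAction (ℚ ≃o ℚ) X] (hU : ∀ V ∈ 𝓤 X, ∃ A : Finset ℚ, ∀ h : ℚ ≃o ℚ, (∀ a ∈ A, h a = a) →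
      ∀ x : X, (h • x, x) ∈ V) (x₀ : X) (F : Finset (ℚ ≃o ℚ)) {V : Set (X × X)} (hV : V ∈ 𝓤 X) :
    ∃ k : ℚ ≃o ℚ, ∀ f ∈ F, (f • k • x₀, k • x₀) ∈ V := by
  obtain ⟨W', hW', hsymm', hWV'⟩ := comp_symm_mem_uniformity_sets hV
  obtain ⟨W, hW, hsymm, hWW⟩ := comp_symm_mem_uniformity_sets hW'
  obtain ⟨A, hA⟩ := hU W hW
  obtain ⟨t, ht, hcov⟩ := (isCompact_univ (X := X)).totallyBounded W hW
  have : Finite t := ht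
  have hcov' : ∀ x : X, ∃ y : t, (x, y.1) ∈ W := fun x => by simpa using hcov (Set.mem_univ x)
  choose col hcol using hcov'
  have hhom : ∀ B : Finset ℚ, ∃ h : ℚ ≃o ℚ, B.card = A.card →
      A.map h.toEquiv.toEmbedding = B := fun B => by
    by_cases h : B.card = A.card
    · exact (exists_orderIso_map_finset h.symm).imp fun _ h _ => h
    · exact ⟨1, fun h' => absurd h' h⟩
  choose h hh using hhom
  let C : Finset ℚ := (insert 1 F).biUnion fun f => A.map (f⁻¹).toEquiv.toEmbedding
  obtain ⟨C', hC', y, hy⟩ :=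
    exists_monochromatic_finset_rat (fun B => col ((h B)⁻¹ • x₀)) A.card C.card
  obtain ⟨k, hk⟩ := exists_orderIso_map_finset hC'.symm
  have key : ∀ f ∈ insert 1 F, (f • k⁻¹ • x₀, y.1) ∈ W' := fun f hf => by
    let B := A.map (k * f⁻¹).toEquiv.toEmbedding
    have hBcard : B.card = A.card := Finset.card_map _
    have hBC : B ⊆ C' := by
      intro b hb
      obtain ⟨a, ha, rfl⟩ := Finset.mem_map.1 hb
      rw [← hk]
      exact Finset.mem_map_of_mem k.toEquiv.toEmbedding (Finset.mem_biUnion.2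
        ⟨f, hf, Finset.mem_map_of_mem (f⁻¹).toEquiv.toEmbedding ha⟩)
    have hagree : ∀ a ∈ A, (f * k⁻¹ * h B) a = a := fun a ha => by
      have := OrderIso.eqOn_of_map_finset_eq (hh B hBcard) a ha
      have e : f * k⁻¹ * h B = (k * f⁻¹)⁻¹ * h B := by group
      rw [e, RelIso.mul_apply, this, ← RelIso.mul_apply, inv_mul_cancel, RelIso.one_apply]
    have h1 := hA _ hagree ((h B)⁻¹ • x₀)
    rw [← mul_smul, mul_assoc, mul_inv_cancel, mul_one, mul_smul] at h1
    have h2 := hcol ((h B)⁻¹ • x₀)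
    rw [hy B hBC hBcard] at h2
    exact hWW ⟨_, h1, h2⟩
  refine ⟨k⁻¹, fun f hf => hWV' ⟨y.1, key f (Finset.mem_insert_of_mem hf), ?_⟩⟩
  have := key 1 (Finset.mem_insert_self _ _)
  rw [one_smul] at this
  exact hsymm'.symm _ _ this

/-- `Aut(ℚ, <)` is extremely amenable; the continuity of the action is expressed through pointwise
stabilizers of finite sets. -/
theorem exists_fixed_of_orderIso_rat {X : Type*} [UniformSpace X] [CompactSpace X] [T0Space X]
    [MulAction (ℚ ≃o ℚ) X] [ContinuousConstSMul (ℚ ≃o ℚ) X]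
    (hU : ∀ V ∈ 𝓤 X, ∃ A : Finset ℚ, ∀ h : ℚ ≃o ℚ, (∀ a ∈ A, h a = a) →
      ∀ x : X, (h • x, x) ∈ V)
    {Y : Set X} (hYc : IsClosed Y) (hYne : Y.Nonempty)
    (hY : ∀ (h : ℚ ≃o ℚ), ∀ x ∈ Y, h • x ∈ Y) :
    ∃ x ∈ Y, ∀ h : ℚ ≃o ℚ, h • x = x := by
  obtain ⟨x₀, hx₀⟩ := hYne
  let ι := (ℚ ≃o ℚ) × {V : Set (X × X) // V ∈ 𝓤 X ∧ IsClosed V}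
  have hne := hYc.isCompact.inter_iInter_nonempty
    (fun i : ι => {x | (i.1 • x, x) ∈ i.2.1})
    (fun i => i.2.2.2.preimage ((continuous_const_smul i.1).prodMk continuous_id))
    (fun u => by
      obtain ⟨k, hk⟩ := exists_forall_smul_near hU x₀ (u.image Prod.fst)
        (V := ⋂ i ∈ u, i.2.1) ((Filter.biInter_finset_mem u).2 fun i _ => i.2.2.1)
      refine ⟨k • x₀, hY _ _ hx₀, Set.mem_iInter₂.2 fun i hi => ?_⟩
      exact Set.mem_iInter₂.1 (hk i.1 (Finset.mem_image_of_mem _ hi)) i hi)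
  obtain ⟨x, hxY, hx⟩ := hne
  refine ⟨x, hxY, fun h => eq_of_uniformity fun hV => ?_⟩
  obtain ⟨W, hW, hWc, hWV⟩ := mem_uniformity_isClosed hV
  exact hWV (Set.mem_iInter.1 hx (h, ⟨W, hW, hWc⟩))

section Ultrametric

variable {S : Set ℝ}

/-- Two points of `U_S` agree at all coordinates at least `r`. -/
def AgreeFrom (r : ℝ) (x y : US S) : Prop :=
  ∀ t : S, r ≤ (t : ℝ) → x.1 t = y.1 t

theorem AgreeFrom.symm {r : ℝ} {x y : US S} (h : AgreeFrom r x y) : AgreeFrom r y x :=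
  fun t ht => (h t ht).symm

theorem AgreeFrom.trans {r : ℝ} {x y z : US S} (h : AgreeFrom r x y) (h' : AgreeFrom r y z) :
    AgreeFrom r x z :=
  fun t ht => (h t ht).trans (h' t ht)

theorem AgreeFrom.mono {r r' : ℝ} (hr : r ≤ r') {x y : US S} (h : AgreeFrom r x y) :
    AgreeFrom r' x y :=
  fun t ht => h t (hr.trans ht)

theorem USsupp.finite {x : S → ℚ} (hx : USsupp S x) {ε : ℝ} (hε : 0 < ε) :
    {t : S | ε ≤ (t : ℝ) ∧ x t ≠ 0}.Finite := by
  obtain ⟨f, -, -, hlim, hsupp⟩ := hx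
  obtain ⟨N, hN⟩ := Filter.eventually_atTop.1 (hlim.eventually (gt_mem_nhds hε))
  refine Set.Finite.of_finite_image (f := Subtype.val) (((Set.finite_Iio N).image f).subset ?_)
    Subtype.val_injective.injOn
  rintro _ ⟨t, ⟨ht, hxt⟩, rfl⟩
  obtain ⟨i, hi⟩ := hsupp t hxt
  refine ⟨i, ?_, hi.symm⟩
  by_contra hiN
  exact absurd (hN i (not_lt.1 hiN)) (not_lt.2 (hi ▸ ht))

theorem USsupp.of_eq_off {x y : S → ℚ} (hx : USsupp S x) {s : S} (hs : 0 < (s : ℝ))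
    (hxy : ∀ t, t ≠ s → y t = x t) : USsupp S y := by
  obtain ⟨f, hf, hfS, hlim, hsupp⟩ := hx
  by_cases hr : ∃ i, (s : ℝ) = f i
  · refine ⟨f, hf, hfS, hlim, fun t ht => ?_⟩
    by_cases hts : t = s
    · rwa [hts]
    · exact hsupp t (hxy t hts ▸ ht)
  have hex : ∃ i, f i < s := (hlim.eventually (gt_mem_nhds hs)).exists
  obtain ⟨n, hn, hmin⟩ : ∃ n, f n < s ∧ ∀ i < n, (s : ℝ) < f i :=
    ⟨Nat.find hex, Nat.find_spec hex, fun i hi =>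
      lt_of_le_of_ne (not_lt.1 (Nat.find_min hex hi)) fun h => hr ⟨i, h⟩⟩
  let g : ℕ → ℝ := fun i => if i < n then f i else if i = n then s else f (i - 1)
  have hlow : ∀ i, i < n → g i = f i := fun i hi => if_pos hi
  have hmid : g n = s := by simp [g]
  have hhigh : ∀ i, n ≤ i → g (i + 1) = f i := fun i hi => by
    simp only [g]
    rw [if_neg (by omega), if_neg (by omega), Nat.add_sub_cancel]
  refine ⟨g, strictAnti_nat_of_succ_lt fun i => ?_, fun i => ?_, ?_, fun t ht => ?_⟩
  · rcases lt_trichotomy i n with hi | rfl | hi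
    · rw [hlow i hi]
      rcases Nat.lt_or_ge (i + 1) n with hi' | hi'
      · rw [hlow _ hi']
        exact hf (Nat.lt_succ_self i)
      · rw [show i + 1 = n by omega, hmid]
        exact hmin i hi
    · rwa [hhigh _ le_rfl, hmid]
    · obtain ⟨j, rfl⟩ : ∃ j, i = j + 1 := ⟨i - 1, by omega⟩
      rw [hhigh _ hi.le, hhigh j (by omega)]
      exact hf (Nat.lt_succ_self j)
  · simp only [g]
    split_ifs
    · exact hfS i
    · exact s.2
    · exact hfS _
  · refine (Filter.tendsto_add_atTop_iff_nat 1).1 (hlim.congr' ?_)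
    filter_upwards [Filter.eventually_ge_atTop n] with i hi
    exact (hhigh i hi).symm
  · by_cases hts : t = s
    · exact ⟨n, by rw [hts, hmid]⟩
    · obtain ⟨i, hi⟩ := hsupp t (hxy t hts ▸ ht)
      rcases Nat.lt_or_ge i n with h | h
      · exact ⟨i, by rw [hlow i h, hi]⟩
      · exact ⟨i + 1, by rw [hhigh i h, hi]⟩

theorem exists_max_ne (hS : ∀ s ∈ S, 0 < s) {x y : US S} (hxy : x ≠ y) :
    ∃ m : S, x.1 m ≠ y.1 m ∧ ∀ t : S, (m : ℝ) < t → x.1 t = y.1 t := by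
  obtain ⟨t₀, ht₀⟩ : ∃ t, x.1 t ≠ y.1 t := by
    by_contra! h
    exact hxy (Subtype.ext (funext h))
  have hpos := hS t₀ t₀.2
  have hfin : {t : S | (t₀ : ℝ) ≤ t ∧ x.1 t ≠ y.1 t}.Finite := by
    refine ((x.2.finite hpos).union (y.2.finite hpos)).subset fun t ht => ?_
    by_cases hx : x.1 t = 0
    · exact Or.inr ⟨ht.1, fun hy => ht.2 (hx.trans hy.symm)⟩
    · exact Or.inl ⟨ht.1, hx⟩
  obtain ⟨m, hm, hmax⟩ := Set.exists_max_image _ (fun t : S => (t : ℝ)) hfin ⟨t₀, le_rfl, ht₀⟩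
  refine ⟨m, hm.2, fun t ht => ?_⟩
  by_contra hne
  exact absurd (hmax t ⟨hm.1.trans ht.le, hne⟩) (not_le.2 ht)

theorem dU_lt_iff (hS : ∀ s ∈ S, 0 < s) {x y : US S} {ε : ℝ} (hε : 0 < ε) :
    dU S x y < ε ↔ AgreeFrom ε x y := by
  by_cases hxy : x = y
  · subst hxy
    simp [dU, hε, AgreeFrom]
  obtain ⟨m, hm, hmax⟩ := exists_max_ne hS hxy
  have hd : dU S x y = m := by
    rw [dU, if_neg hxy]
    refine IsLeast.csInf_eq ⟨⟨m.2, hmax⟩, fun r hr => ?_⟩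
    by_contra hlt
    exact hm (hr.2 m (not_le.1 hlt))
  rw [hd]
  refine ⟨fun h t ht => hmax t (h.trans_le ht), fun h => ?_⟩
  by_contra hle
  exact hm (h m (not_lt.1 hle))

theorem lt_iff_lexU {x y : US S} {d : S} (h : ∀ t : S, (d : ℝ) < t → x.1 t = y.1 t) :
    x.1 d < y.1 d ↔ lexU S x y ∧ ¬ AgreeFrom d x y := by
  refine ⟨fun hlt => ⟨⟨d, hlt, h⟩, fun ha => hlt.ne (ha d le_rfl)⟩, ?_⟩
  rintro ⟨⟨s, hs, hs'⟩, hna⟩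
  rcases lt_trichotomy (s : ℝ) d with hsd | hsd | hsd
  · exact absurd (fun t ht => hs' t (hsd.trans_le ht)) hna
  · rwa [Subtype.ext hsd] at hs
  · exact absurd (h s hsd) hs.ne

instance : MulAction (AutU S) (US S) where
  smul g x := g.1 x
  one_smul _ := rfl
  mul_smul _ _ _ := rfl

theorem agreeFrom_smul_iff (hS : ∀ s ∈ S, 0 < s) (g : AutU S) {x y : US S} {ε : ℝ}
    (hε : 0 < ε) : AgreeFrom ε (g • x) (g • y) ↔ AgreeFrom ε x y := by
  rw [← dU_lt_iff hS hε, ← dU_lt_iff hS hε]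
  exact iff_of_eq (congrArg (· < ε) (g.2.1 x y))

theorem lexU_smul_iff (g : AutU S) {x y : US S} : lexU S (g • x) (g • y) ↔ lexU S x y :=
  g.2.2 x y

theorem cmp_smul_eq (hS : ∀ s ∈ S, 0 < s) (g : AutU S) {x y : US S} {d : S}
    (h : ∀ t : S, (d : ℝ) < t → x.1 t = y.1 t)
    (h' : ∀ t : S, (d : ℝ) < t → (g • x).1 t = (g • y).1 t) :
    cmp (x.1 d) (y.1 d) = cmp ((g • x).1 d) ((g • y).1 d) := by
  have key : ∀ x y : US S, (∀ t : S, (d : ℝ) < t → x.1 t = y.1 t) →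
      (∀ t : S, (d : ℝ) < t → (g • x).1 t = (g • y).1 t) →
      (x.1 d < y.1 d ↔ (g • x).1 d < (g • y).1 d) := fun x y h h' => by
    rw [lt_iff_lexU h, lt_iff_lexU h', lexU_smul_iff, agreeFrom_smul_iff hS g (hS d d.2)]
  have h1 := key x y h h'
  have h2 := key y x (fun t ht => (h t ht).symm) (fun t ht => (h' t ht).symm)
  rcases lt_trichotomy (x.1 d) (y.1 d) with hlt | heq | hgt
  · rw [(cmp_eq_lt_iff _ _).2 hlt, (cmp_eq_lt_iff _ _).2 (h1.1 hlt)]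
  · rw [(cmp_eq_eq_iff _ _).2 heq, eq_comm, cmp_eq_eq_iff]
    exact le_antisymm (not_lt.1 fun hlt => (h2.2 hlt).ne heq.symm)
      (not_lt.1 fun hlt => (h1.2 hlt).ne heq)
  · rw [(cmp_eq_gt_iff _ _).2 hgt, (cmp_eq_gt_iff _ _).2 (h2.1 hgt)]

theorem exists_agreeFrom_of_mem_nhds_one (hS : ∀ s ∈ S, 0 < s) {N : Set (AutU S)}
    (hN : N ∈ nhds (1 : AutU S)) :
    ∃ A : Finset (US S), ∃ ε : ℝ, 0 < ε ∧
      ∀ g : AutU S, (∀ x ∈ A, AgreeFrom ε (g • x) x) → g ∈ N := by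
  let 𝓕 : Filter (AutU S) :=
    { sets := {N | ∃ A : Finset (US S), ∃ ε : ℝ, 0 < ε ∧
        ∀ g : AutU S, (∀ x ∈ A, AgreeFrom ε (g • x) x) → g ∈ N}
      univ_sets := ⟨∅, 1, one_pos, fun _ _ => trivial⟩
      sets_of_superset := by
        rintro M N ⟨A, ε, hε, h⟩ hMN
        exact ⟨A, ε, hε, fun g hg => hMN (h g hg)⟩
      inter_sets := by
        rintro M N ⟨A, ε, hε, h⟩ ⟨B, δ, hδ, h'⟩
        refine ⟨A ∪ B, min ε δ, lt_min hε hδ, fun g hg => ⟨h g fun x hx => ?_, h' g fun x hx => ?_⟩⟩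
        · exact (hg x (Finset.mem_union_left _ hx)).mono (min_le_left _ _)
        · exact (hg x (Finset.mem_union_right _ hx)).mono (min_le_right _ _) }
  suffices h : 𝓕 ≤ nhds 1 from h hN
  have hball : ∀ x y : US S, ∀ ε : ℝ, 0 < ε → dU S y x < ε → ∀ z, AgreeFrom ε z x →
      dU S y z < ε := fun x y ε hε hyx z hz => by
    rw [dU_lt_iff hS hε] at hyx ⊢
    exact hyx.trans hz.symm
  rw [nhds_induced, ← Filter.tendsto_iff_comap]
  refine Filter.Tendsto.prodMk_nhds (tendsto_pi_nhds.2 fun x => ?_) (tendsto_pi_nhds.2 fun x => ?_)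
  · refine TopologicalSpace.tendsto_nhds_generateFrom_iff.2 ?_
    rintro _ ⟨y, ε, hε, rfl⟩ hx
    exact ⟨{x}, ε, hε, fun g hg => hball x y ε hε hx _ (hg x (Finset.mem_singleton_self x))⟩
  · refine TopologicalSpace.tendsto_nhds_generateFrom_iff.2 ?_
    rintro _ ⟨y, ε, hε, rfl⟩ hx
    refine ⟨{x}, ε, hε, fun g hg => hball x y ε hε hx _ ?_⟩
    have := (agreeFrom_smul_iff hS g⁻¹ hε).2 (hg x (Finset.mem_singleton_self x))
    rw [inv_smul_smul] at this
    exact this.symm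

end Ultrametric

section Level

variable {S : Set ℝ}

/-- The restriction of `x` to the coordinates strictly above `s`, extended by zero. -/
noncomputable def truncAbove (s : S) (x : S → ℚ) : S → ℚ :=
  fun t => if (s : ℝ) < t then x t else 0

theorem truncAbove_congr {s : S} {x y : S → ℚ} (h : ∀ t : S, (s : ℝ) < t → x t = y t) :
    truncAbove s x = truncAbove s y := by
  funext t
  simp only [truncAbove]
  split_ifs with ht
  · exact h t ht
  · rfl

theorem eq_of_truncAbove_eq {s : S} {x y : S → ℚ} (h : truncAbove s x = truncAbove s y) {t : S}
    (ht : (s : ℝ) < t) : x t = y t := by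
  simpa [truncAbove, ht] using congrFun h t

/-- Modify the coordinate `s` of `x` by an automorphism of `ℚ` that depends on the coordinates
above `s`. -/
noncomputable def levelMap (s : S) (σ : (S → ℚ) → ℚ ≃o ℚ) (x : S → ℚ) : S → ℚ :=
  fun t => if t = s then σ (truncAbove s x) (x s) else x t

theorem levelMap_self (s : S) (σ : (S → ℚ) → ℚ ≃o ℚ) (x : S → ℚ) :
    levelMap s σ x s = σ (truncAbove s x) (x s) :=
  if_pos rfl

theorem levelMap_of_ne {s t : S} (h : t ≠ s) (σ : (S → ℚ) → ℚ ≃o ℚ) (x : S → ℚ) :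
    levelMap s σ x t = x t :=
  if_neg h

theorem truncAbove_levelMap (s : S) (σ : (S → ℚ) → ℚ ≃o ℚ) (x : S → ℚ) :
    truncAbove s (levelMap s σ x) = truncAbove s x :=
  truncAbove_congr fun t ht => levelMap_of_ne (fun h => ht.ne (by rw [h])) σ x

theorem levelMap_mul (s : S) (σ τ : (S → ℚ) → ℚ ≃o ℚ) (x : S → ℚ) :
    levelMap s (σ * τ) x = levelMap s σ (levelMap s τ x) := by
  funext t
  by_cases h : t = s
  · subst h
    simp only [levelMap_self, truncAbove_levelMap, Pi.mul_apply, RelIso.mul_apply]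
  · simp only [levelMap_of_ne h]

theorem levelMap_one (s : S) (x : S → ℚ) : levelMap s 1 x = x := by
  funext t
  by_cases h : t = s
  · subst h
    simp [levelMap_self]
  · simp only [levelMap_of_ne h]

theorem levelMap_congr_above {s : S} (σ : (S → ℚ) → ℚ ≃o ℚ) {x y : S → ℚ} {t : S}
    (h : ∀ u : S, (t : ℝ) ≤ u → x u = y u) : levelMap s σ x t = levelMap s σ y t := by
  by_cases hts : t = s
  · subst hts
    rw [levelMap_self, levelMap_self, h t le_rfl, truncAbove_congr fun u hu => h u hu.le]
  · rw [levelMap_of_ne hts, levelMap_of_ne hts, h t le_rfl]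

/-- Conjugating a modification at a coordinate `s` by one at a higher coordinate `d` gives again a
modification at `s`. -/
theorem levelMap_comm_of_lt {s d : S} (hsd : (s : ℝ) < d) (σ τ : (S → ℚ) → ℚ ≃o ℚ) (x : S → ℚ) :
    levelMap s σ (levelMap d τ x) =
      levelMap d τ (levelMap s (fun q => σ (truncAbove s (levelMap d τ q))) x) := by
  have hne : s ≠ d := fun h => hsd.ne (by rw [h])
  funext t
  by_cases hts : t = s
  · subst hts
    rw [levelMap_self, levelMap_of_ne hne, levelMap_of_ne hne, levelMap_self]
    congr 2
    refine truncAbove_congr fun u hu => levelMap_congr_above τ fun v hv => ?_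
    simp [truncAbove, hu.trans_le hv]
  · rw [levelMap_of_ne hts]
    by_cases htd : t = d
    · subst htd
      rw [levelMap_self, levelMap_self, levelMap_of_ne hts]
      congr 2
      exact truncAbove_congr fun u hu =>
        (levelMap_of_ne (fun h => (hsd.trans hu).ne (by rw [h])) _ _).symm
    · rw [levelMap_of_ne htd, levelMap_of_ne htd, levelMap_of_ne hts]

/-- The permutation of `U_S` given by `levelMap`. -/
noncomputable def levelEquiv (hS : ∀ s ∈ S, 0 < s) (s : S) (σ : (S → ℚ) → ℚ ≃o ℚ) :
    US S ≃ US S where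
  toFun x := ⟨levelMap s σ x.1, x.2.of_eq_off (hS s s.2) fun _ ht => levelMap_of_ne ht σ x.1⟩
  invFun x := ⟨levelMap s σ⁻¹ x.1, x.2.of_eq_off (hS s s.2) fun _ ht => levelMap_of_ne ht σ⁻¹ x.1⟩
  left_inv x := Subtype.ext (by
    simp only
    rw [← levelMap_mul, inv_mul_cancel, levelMap_one])
  right_inv x := Subtype.ext (by
    simp only
    rw [← levelMap_mul, mul_inv_cancel, levelMap_one])

theorem levelMap_agree_iff (s : S) (σ : (S → ℚ) → ℚ ≃o ℚ) (x y : S → ℚ) (r : ℝ) :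
    (∀ t : S, r < t → levelMap s σ x t = levelMap s σ y t) ↔ ∀ t : S, r < t → x t = y t := by
  have key : ∀ (σ : (S → ℚ) → ℚ ≃o ℚ) (x y : S → ℚ), (∀ t : S, r < t → x t = y t) →
      ∀ t : S, r < t → levelMap s σ x t = levelMap s σ y t := fun σ x y h t ht =>
    levelMap_congr_above σ fun u hu => h u (ht.trans_le hu)
  refine ⟨fun h => ?_, key σ x y⟩
  have := key σ⁻¹ _ _ h
  rwa [← levelMap_mul, ← levelMap_mul, inv_mul_cancel, levelMap_one, levelMap_one] at this

theorem levelMap_lt_iff {s : S} (σ : (S → ℚ) → ℚ ≃o ℚ) {x y : S → ℚ} {t : S}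
    (h : ∀ u : S, (t : ℝ) < u → x u = y u) :
    levelMap s σ x t < levelMap s σ y t ↔ x t < y t := by
  by_cases hts : t = s
  · subst hts
    rw [levelMap_self, levelMap_self, truncAbove_congr h, OrderIso.lt_iff_lt]
  · rw [levelMap_of_ne hts, levelMap_of_ne hts]

theorem levelEquiv_val (hS : ∀ s ∈ S, 0 < s) (s : S) (σ : (S → ℚ) → ℚ ≃o ℚ) (x : US S) :
    (levelEquiv hS s σ x).1 = levelMap s σ x.1 :=
  rfl

/-- The automorphisms of `U_S` that modify only the coordinate `s`. -/
noncomputable def levelAut (hS : ∀ s ∈ S, 0 < s) (s : S) :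
    ((S → ℚ) → ℚ ≃o ℚ) →* AutU S where
  toFun σ := ⟨levelEquiv hS s σ, by
    intro x y
    simp only [dU, EmbeddingLike.apply_eq_iff_eq, levelEquiv_val, levelMap_agree_iff], by
    intro x y
    refine exists_congr fun t => ?_
    simp only [levelEquiv_val, levelMap_agree_iff]
    exact and_congr_left fun h => levelMap_lt_iff σ h⟩
  map_one' := Subtype.ext (Equiv.ext fun x => Subtype.ext (levelMap_one s x.1))
  map_mul' σ τ := Subtype.ext (Equiv.ext fun x => Subtype.ext (levelMap_mul s σ τ x.1))

theorem levelAut_smul_val (hS : ∀ s ∈ S, 0 < s) (s : S) (σ : (S → ℚ) → ℚ ≃o ℚ) (x : US S) :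
    (levelAut hS s σ • x).1 = levelMap s σ x.1 :=
  rfl

theorem levelAut_comm_of_lt (hS : ∀ s ∈ S, 0 < s) {s d : S} (hsd : (s : ℝ) < d)
    (σ τ : (S → ℚ) → ℚ ≃o ℚ) :
    levelAut hS s σ * levelAut hS d τ =
      levelAut hS d τ * levelAut hS s fun q => σ (truncAbove s (levelMap d τ q)) :=
  Subtype.ext (Equiv.ext fun x => Subtype.ext (levelMap_comm_of_lt hsd σ τ x.1))

theorem levelAut_smul_eq_of_eqOn (hS : ∀ s ∈ S, 0 < s) (s : S) {σ τ : (S → ℚ) → ℚ ≃o ℚ}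
    {x : US S} (h : σ (truncAbove s x.1) (x.1 s) = τ (truncAbove s x.1) (x.1 s)) :
    levelAut hS s σ • x = levelAut hS s τ • x := by
  refine Subtype.ext (funext fun t => ?_)
  rw [levelAut_smul_val, levelAut_smul_val]
  by_cases hts : t = s
  · subst hts
    rwa [levelMap_self, levelMap_self]
  · rw [levelMap_of_ne hts, levelMap_of_ne hts]

end Level

section FixedPoints

variable {S : Set ℝ} {X : Type*} [MulAction (AutU S) X]

variable (X) in
/-- The points of `X` fixed by all automorphisms that modify only the coordinate `s`. -/
def levelFixed (hS : ∀ s ∈ S, 0 < s) (s : S) : Set X :=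
  {x | ∀ σ : (S → ℚ) → ℚ ≃o ℚ, levelAut hS s σ • x = x}

theorem smul_ite_eq_of_fixed_single {hS : ∀ s ∈ S, 0 < s} {s : S} {x : X}
    (hx : ∀ p (h : ℚ ≃o ℚ), levelAut hS s (Pi.mulSingle p h) • x = x)
    (σ : (S → ℚ) → ℚ ≃o ℚ) (B : Finset (S → ℚ)) :
    levelAut hS s (fun q => if q ∈ B then σ q else 1) • x = x := by
  induction B using Finset.induction_on with
  | empty =>
    have : (fun q => if q ∈ (∅ : Finset (S → ℚ)) then σ q else 1) = 1 := by
      funext q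
      simp
    rw [this, map_one, one_smul]
  | insert p B hp ih =>
    have : (fun q => if q ∈ insert p B then σ q else 1) =
        Pi.mulSingle p (σ p) * fun q => if q ∈ B then σ q else 1 := by
      funext q
      by_cases hq : q = p
      · subst hq
        simp [hp]
      · simp [hq]
    rw [this, map_mul, mul_smul, ih, hx]

/-- If all the level groups fix `x`, then on finitely many points and on a finite set `D` of
coordinates every automorphism `g` coincides with one that fixes `x` and leaves the coordinates
outside `D` alone, provided that `g` preserves those coordinates outside `D` that exceed some
element of `D`. -/
theorem exists_smul_eq_on_coords {hS : ∀ s ∈ S, 0 < s} {x : X}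
    (hx : ∀ s, x ∈ levelFixed X hS s) (g : AutU S) (A : Finset (US S)) (D : Finset S) :
    (∀ y ∈ A, ∀ t : S, (∃ d ∈ D, d ≤ t) → t ∉ D → y.1 t = (g • y).1 t) →
    ∃ e : AutU S, e • x = x ∧
      ∀ y ∈ A, ∀ t : S, (t ∉ D → (e • y).1 t = y.1 t) ∧ (t ∈ D → (e • y).1 t = (g • y).1 t) := by
  induction D using Finset.induction_on_min with
  | empty => exact fun _ => ⟨1, one_smul _ _, fun y _ t => by simp⟩
  | insert d D hD ih =>
    intro hg
    obtain ⟨e, hex, he⟩ := ih fun y hy t ⟨d', hd', hle⟩ ht => by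
      refine hg y hy t ⟨d', Finset.mem_insert_of_mem hd', hle⟩ fun hmem => ?_
      rcases Finset.mem_insert.1 hmem with rfl | hmem
      · exact absurd (hD d' hd') (not_lt.2 hle)
      · exact ht hmem
    have habove : ∀ y ∈ A, ∀ t : S, (d : ℝ) < t → (e • y).1 t = (g • y).1 t := by
      intro y hy t ht
      by_cases htD : t ∈ D
      · exact (he y hy t).2 htD
      · rw [(he y hy t).1 htD]
        refine hg y hy t ⟨d, Finset.mem_insert_self _ _, ht.le⟩ fun hmem => ?_
        rcases Finset.mem_insert.1 hmem with rfl | hmem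
        · exact lt_irrefl _ ht
        · exact htD hmem
    have hσ : ∀ q : S → ℚ, ∃ h : ℚ ≃o ℚ, ∀ y ∈ A, truncAbove d (e • y).1 = q →
        h ((e • y).1 d) = (g • y).1 d := by
      intro q
      obtain ⟨h, hh⟩ := Order.PartialIso.exists_orderIso
        (⟨(A.filter fun y => truncAbove d (e • y).1 = q).image
            fun y => ((e • y).1 d, (g • y).1 d), by
          simp only [Finset.mem_image, Finset.mem_filter]
          rintro _ ⟨y, ⟨hy, hyq⟩, rfl⟩ _ ⟨z, ⟨hz, hzq⟩, rfl⟩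
          have hyz : ∀ t : S, (d : ℝ) < t → (e • y).1 t = (e • z).1 t := fun t ht =>
            eq_of_truncAbove_eq (hyq.trans hzq.symm) ht
          have hge : ∀ y : US S, (g * e⁻¹) • e • y = g • y := fun y => by
            rw [← mul_smul, inv_mul_cancel_right]
          have := cmp_smul_eq hS (g * e⁻¹) hyz (fun t ht => by
            rw [hge, hge, ← habove y hy t ht, ← habove z hz t ht, hyz t ht])
          rwa [hge, hge] at this⟩ : Order.PartialIso ℚ ℚ)
      exact ⟨h, fun y hy hyq => hh _ (Finset.mem_image_of_mem _ (Finset.mem_filter.2 ⟨hy, hyq⟩))⟩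
    choose σ hσ using hσ
    refine ⟨levelAut hS d σ * e, by rw [mul_smul, hex, hx d σ], fun y hy t => ?_⟩
    rw [mul_smul, levelAut_smul_val]
    by_cases htd : t = d
    · subst htd
      refine ⟨fun h => absurd (Finset.mem_insert_self _ _) h, fun _ => ?_⟩
      rw [levelMap_self, hσ _ y hy rfl]
    · rw [levelMap_of_ne htd, Finset.mem_insert, or_iff_right htd]
      exact he y hy t

variable [UniformSpace X]

variable (S X) in
/-- Automorphisms close to the identity of `U_S` move all points of `X` uniformly little. -/
def ActsUniformly : Prop :=
  ∀ V ∈ 𝓤 X, ∃ A : Finset (US S), ∃ ε : ℝ, 0 < ε ∧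
    ∀ g : AutU S, (∀ y ∈ A, AgreeFrom ε (g • y) y) → ∀ x : X, (g • x, x) ∈ V

theorem isClosed_levelFixed [T2Space X] [ContinuousConstSMul (AutU S) X]
    (hS : ∀ s ∈ S, 0 < s) (s : S) : IsClosed (levelFixed X hS s) := by
  simp only [levelFixed, Set.ofPred_forall]
  exact isClosed_iInter fun σ => isClosed_eq (continuous_const_smul _) continuous_id

theorem smul_eq_of_forall_exists_agreeFrom [T0Space X] (hS : ∀ s ∈ S, 0 < s)
    (hU : ActsUniformly S X) {x : X} {g : AutU S}
    (h : ∀ (A : Finset (US S)) (ε : ℝ), 0 < ε →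
      ∃ e : AutU S, e • x = x ∧ ∀ y ∈ A, AgreeFrom ε (e • y) (g • y)) : g • x = x := by
  have hinv : g⁻¹ • x = x := eq_of_uniformity fun {V} hV => by
    obtain ⟨A, ε, hε, hA⟩ := hU V hV
    obtain ⟨e, hex, he⟩ := h A ε hε
    have := hA (g⁻¹ * e) (fun y hy => by
      rw [← agreeFrom_smul_iff hS g hε, ← mul_smul, mul_inv_cancel_left]
      exact he y hy) x
    rwa [mul_smul, hex] at this
  rw [inv_smul_eq_iff] at hinv
  exact hinv.symm

theorem exists_mem_fixed_single [CompactSpace X] [T2Space X] [ContinuousConstSMul (AutU S) X]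
    (hS : ∀ s ∈ S, 0 < s) (hU : ActsUniformly S X) (s : S) (p : S → ℚ) {Y : Set X}
    (hYc : IsClosed Y) (hYne : Y.Nonempty)
    (hY : ∀ h : ℚ ≃o ℚ, ∀ x ∈ Y, levelAut hS s (Pi.mulSingle p h) • x ∈ Y) :
    ∃ x ∈ Y, ∀ h : ℚ ≃o ℚ, levelAut hS s (Pi.mulSingle p h) • x = x := by
  let : MulAction (ℚ ≃o ℚ) X :=
    MulAction.compHom X ((levelAut hS s).comp (MonoidHom.mulSingle (fun _ => ℚ ≃o ℚ) p))
  have : ContinuousConstSMul (ℚ ≃o ℚ) X :=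
    ⟨fun h => continuous_const_smul (levelAut hS s (Pi.mulSingle p h))⟩
  refine exists_fixed_of_orderIso_rat (fun V hV => ?_) hYc hYne hY
  obtain ⟨A, ε, -, hA⟩ := hU V hV
  refine ⟨A.image fun y => y.1 s, fun h hh => hA (levelAut hS s (Pi.mulSingle p h)) fun y hy => ?_⟩
  have : levelAut hS s (Pi.mulSingle p h) • y = levelAut hS s 1 • y := by
    refine levelAut_smul_eq_of_eqOn hS s ?_
    by_cases hp : truncAbove s y.1 = p
    · rw [hp, Pi.mulSingle_eq_same]
      exact hh _ (Finset.mem_image_of_mem _ hy)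
    · rw [Pi.mulSingle_eq_of_ne hp]
      rfl
  rw [this, map_one, one_smul]
  exact fun _ _ => rfl

theorem exists_mem_levelFixed [CompactSpace X] [T2Space X] [ContinuousConstSMul (AutU S) X]
    (hS : ∀ s ∈ S, 0 < s) (hU : ActsUniformly S X) (s : S) {Y : Set X}
    (hYc : IsClosed Y) (hYne : Y.Nonempty)
    (hY : ∀ σ : (S → ℚ) → ℚ ≃o ℚ, ∀ x ∈ Y, levelAut hS s σ • x ∈ Y) :
    (Y ∩ levelFixed X hS s).Nonempty := by
  let t : (S → ℚ) → Set X := fun p => {x | ∀ h : ℚ ≃o ℚ, levelAut hS s (Pi.mulSingle p h) • x = x}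
  have ht : ∀ p, IsClosed (t p) := fun p => by
    simp only [t, Set.ofPred_forall]
    exact isClosed_iInter fun h => isClosed_eq (continuous_const_smul _) continuous_id
  have hfin : ∀ P : Finset (S → ℚ), (Y ∩ ⋂ p ∈ P, t p).Nonempty := fun P => by
    induction P using Finset.induction_on with
    | empty => simpa using hYne
    | insert p P hp ih =>
      obtain ⟨x, hx, hxp⟩ := exists_mem_fixed_single hS hU s p
        (hYc.inter (isClosed_biInter fun q _ => ht q)) ih (fun h x hx => by
          refine ⟨hY _ x hx.1, Set.mem_iInter₂.2 fun q hq k => ?_⟩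
          have hqp : q ≠ p := fun h => hp (h ▸ hq)
          have hcomm : Commute (Pi.mulSingle q k : (S → ℚ) → ℚ ≃o ℚ) (Pi.mulSingle p h) :=
            Pi.mulSingle_commute (f := fun _ => ℚ ≃o ℚ) hqp k h
          rw [← mul_smul, ← map_mul, hcomm.eq, map_mul, mul_smul,
            Set.mem_iInter₂.1 hx.2 q hq k])
      refine ⟨x, hx.1, ?_⟩
      rw [Finset.set_biInter_insert]
      exact ⟨hxp, hx.2⟩
  obtain ⟨x, hxY, hx⟩ := hYc.isCompact.inter_iInter_nonempty t ht hfin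
  refine ⟨x, hxY, fun σ => smul_eq_of_forall_exists_agreeFrom hS hU fun A ε _ => ?_⟩
  refine ⟨_, smul_ite_eq_of_fixed_single (fun p => Set.mem_iInter.1 hx p) σ
    (A.image fun y => truncAbove s y.1), fun y hy => ?_⟩
  rw [levelAut_smul_eq_of_eqOn hS s (τ := σ)]
  · exact fun _ _ => rfl
  · exact congrArg (fun h : ℚ ≃o ℚ => h (y.1 s)) (if_pos (Finset.mem_image_of_mem _ hy))

theorem exists_mem_iInter_levelFixed [CompactSpace X] [T2Space X] [Nonempty X]
    [ContinuousConstSMul (AutU S) X] (hS : ∀ s ∈ S, 0 < s) (hU : ActsUniformly S X) :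
    ∃ x : X, ∀ s, x ∈ levelFixed X hS s := by
  have hfin : ∀ D : Finset S, (⋂ s ∈ D, levelFixed X hS s).Nonempty := fun D => by
    induction D using Finset.induction_on_max with
    | empty => simp
    | insert d D hD ih =>
      rw [Finset.set_biInter_insert, Set.inter_comm]
      refine exists_mem_levelFixed hS hU d
        (isClosed_biInter fun s _ => isClosed_levelFixed hS s) ih fun τ x hx => ?_
      refine Set.mem_iInter₂.2 fun s hs σ => ?_
      rw [← mul_smul, levelAut_comm_of_lt hS (hD s hs), mul_smul, Set.mem_iInter₂.1 hx s hs]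
  obtain ⟨x, hx⟩ := CompactSpace.iInter_nonempty (fun s => isClosed_levelFixed hS s) hfin
  exact ⟨x, Set.mem_iInter.1 hx⟩

theorem smul_eq_of_mem_levelFixed [T0Space X] {hS : ∀ s ∈ S, 0 < s} (hU : ActsUniformly S X)
    {x : X} (hx : ∀ s, x ∈ levelFixed X hS s) (g : AutU S) : g • x = x := by
  refine smul_eq_of_forall_exists_agreeFrom hS hU fun A ε hε => ?_
  have hfin : (⋃ y ∈ A, ({t : S | ε ≤ (t : ℝ) ∧ y.1 t ≠ 0} ∪
      {t : S | ε ≤ (t : ℝ) ∧ (g • y).1 t ≠ 0})).Finite :=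
    A.finite_toSet.biUnion fun y _ => (y.2.finite hε).union ((g • y).2.finite hε)
  have hzero : ∀ y ∈ A, ∀ t : S, ε ≤ (t : ℝ) → t ∉ hfin.toFinset → y.1 t = (g • y).1 t := by
    intro y hy t ht htD
    simp only [Set.Finite.mem_toFinset, Set.mem_iUnion, Set.mem_union, not_exists, not_or] at htD
    have h := htD y hy
    have h1 : y.1 t = 0 := by_contra fun hne => h.1 ⟨ht, hne⟩
    have h2 : (g • y).1 t = 0 := by_contra fun hne => h.2 ⟨ht, hne⟩
    rw [h1, h2]
  obtain ⟨e, hex, he⟩ := exists_smul_eq_on_coords hx g A hfin.toFinset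
    fun y hy t ⟨d, hd, hdt⟩ htD => by
      refine hzero y hy t (le_trans ?_ hdt) htD
      simp only [Set.Finite.mem_toFinset, Set.mem_iUnion] at hd
      obtain ⟨z, -, hz | hz⟩ := hd
      exacts [hz.1, hz.1]
  refine ⟨e, hex, fun y hy t ht => ?_⟩
  by_cases htD : t ∈ hfin.toFinset
  · exact (he y hy t).2 htD
  · rw [(he y hy t).1 htD, hzero y hy t ht htD]

end FixedPoints

/-- `Aut(U_S, <lex)` is extremely amenable: every continuous action on a nonempty
compact Hausdorff space has a fixed point. -/
theorem AutU_extremely_amenable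
    (S : Set ℝ) (hScount : S.Countable) (hSpos : ∀ s ∈ S, 0 < s)
    (hacc : ∀ ε > 0, ∃ s ∈ S, s < ε)
    (X : Type*) [TopologicalSpace X] [CompactSpace X] [T2Space X] [Nonempty X]
    (a : AutU S → X → X)
    (ha_one : ∀ x, a 1 x = x)
    (ha_mul : ∀ g h x, a (g * h) x = a g (a h x))
    (ha_cont : Continuous fun p : AutU S × X => a p.1 p.2) :
    ∃ x : X, ∀ g : AutU S, a g x = x := by
  let : MulAction (AutU S) X :=
    { smul := a
      one_smul := ha_one
      mul_smul := ha_mul }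
  have : ContinuousConstSMul (AutU S) X :=
    ⟨fun g => ha_cont.comp (continuous_const.prodMk continuous_id)⟩
  let : UniformSpace X := uniformSpaceOfCompactR1
  have hU : ActsUniformly S X := fun V hV => by
    obtain ⟨N, hN, hNV⟩ := isCompact_univ.mem_uniformity_of_prod (f := a) (s := Set.univ)
      ha_cont.continuousOn (Set.mem_univ 1) hV
    rw [nhdsWithin_univ] at hN
    obtain ⟨A, ε, hε, hA⟩ := exists_agreeFrom_of_mem_nhds_one hSpos hN
    refine ⟨A, ε, hε, fun g hg x => ?_⟩
    have := hNV g (hA g hg) x (Set.mem_univ x)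
    rwa [ha_one] at this
  obtain ⟨x, hx⟩ := exists_mem_iInter_levelFixed hSpos hU
  exact ⟨x, smul_eq_of_mem_levelFixed hU hx⟩
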